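/- J_BS is differentiable on (0, ∞), and as k → 1 its derivative satisfies J_BS′(k) = (3/k)·log k·(1 − (3/10)·log k + (109/1050)·log²k + O(log³k)); that is, k ↦ (k·J_BS′(k)/(3·log k) − 1 + (3/10)log k − (109/1050)log²k)/log³k is bounded in a punctured neighborhood of k = 1. -/

import Mathlib

/-- `sinh β / β`, extended by its limiting value `1` at `β = 0`. -/
noncomputable def sinhc (b : ℝ) : ℝ := if b = 0 then 1 else Real.sinh b / b

/-- `sin (2ξ) / (2ξ)`, extended by its limiting value `1` at `ξ = 0`. -/
noncomputable def sinc2 (x : ℝ) : ℝ := if x = 0 then 1 else Real.sin (2 * x) / (2 * x)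

/-- `J` is the Black–Scholes Asian rate function `J_BS`: for `k ≥ 1`,
`J k = β²/2 − β·tanh(β/2)` where `β ≥ 0` solves `sinh β/β = k`, and for `0 < k ≤ 1`,
`J k = 2ξ(tan ξ − ξ)` where `ξ ∈ [0, π/2]` solves `sin(2ξ)/(2ξ) = k`. -/
def IsJBS (J : ℝ → ℝ) : Prop :=
  (∀ k : ℝ, 1 ≤ k → ∀ β : ℝ, 0 ≤ β → sinhc β = k →
      J k = β ^ 2 / 2 - β * Real.tanh (β / 2)) ∧
  (∀ k : ℝ, 0 < k → k ≤ 1 → ∀ ξ : ℝ, ξ ∈ Set.Icc 0 (Real.pi / 2) → sinc2 ξ = k →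
      J k = 2 * ξ * (Real.tan ξ - ξ))

open Real Set Filter Topology

theorem exists_eq_mul_of_abs_le {x y C : ℝ} (hC : 0 ≤ C) (h : |x| ≤ C * |y|) :
    ∃ e, |e| ≤ C ∧ x = e * y := by
  rcases eq_or_ne y 0 with rfl | hy
  · exact ⟨0, by simpa using hC, by simpa using h⟩
  · refine ⟨x / y, ?_, by field_simp⟩
    rw [abs_div, div_le_iff₀ (abs_pos.2 hy)]
    exact h

theorem exists_log_eq_cubic {u : ℝ} (hu : |u| ≤ 1 / 2) :
    ∃ e, |e| ≤ 2 ∧ log (1 + u) = u - u ^ 2 / 2 + u ^ 3 / 3 + e * u ^ 4 := by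
  have h := abs_log_sub_add_sum_range_le (x := -u) (by rw [abs_neg]; linarith) 3
  rw [abs_neg] at h
  have h2 : |u| ^ 4 / (1 - |u|) ≤ 2 * |u ^ 4| := by
    rw [div_le_iff₀ (by linarith), abs_pow]
    nlinarith [pow_nonneg (abs_nonneg u) 4]
  obtain ⟨e, he, h3⟩ := exists_eq_mul_of_abs_le (by norm_num) (h.trans h2)
  refine ⟨e, he, ?_⟩
  norm_num [Finset.sum_range_succ] at h3
  linarith

theorem exists_forall_abs_le_of_continuous {f : ℝ × ℝ × ℝ → ℝ} (hf : Continuous f) (K : ℝ) :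
    ∃ C > 0, ∀ x y z : ℝ, |x| ≤ K → |y| ≤ K → |z| ≤ K → |f (x, y, z)| ≤ C := by
  obtain ⟨C, hC⟩ := ((isCompact_Icc (a := -K) (b := K)).prod
    ((isCompact_Icc (a := -K) (b := K)).prod
      (isCompact_Icc (a := -K) (b := K)))).exists_bound_of_continuousOn hf.continuousOn
  refine ⟨max C 1, by positivity, fun x y z hx hy hz => ?_⟩
  exact (hC (x, y, z) ⟨abs_le.1 hx, abs_le.1 hy, abs_le.1 hz⟩).trans (le_max_left _ _)

/-- Third-order expansion of the logarithm of a function with the Taylor polynomial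
of `sinh √s / √s`. -/
theorem exists_log_sinhc_expansion :
    ∃ K > 0, ∀ s a : ℝ, |s| ≤ 1 / 4 → |a| ≤ 1 →
      ∃ E, |E| ≤ K ∧
        log (1 + s / 6 + s ^ 2 / 120 + s ^ 3 / 5040 + a * s ^ 4) =
          s / 6 - s ^ 2 / 180 + s ^ 3 / 2835 + E * s ^ 4 ∧
        |s| ≤ 24 * |log (1 + s / 6 + s ^ 2 / 120 + s ^ 3 / 5040 + a * s ^ 4)| := by
  obtain ⟨K, hK, hE⟩ := exists_forall_abs_le_of_continuous
    (f := fun p : ℝ × ℝ × ℝ =>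
      (11/67200) + (1/64800) * p.1 + (23/31752000) * p.1^2 + (31/1524096000) * p.1^3
        + (1/3048192000) * p.1^4 + (1/384072192000) * p.1^5
        + p.2.1 * (1 - (2 * (p.1 / 6 + p.1^2 / 120 + p.1^3 / 5040) + p.2.1 * p.1^4) / 2
          + (3 * (p.1 / 6 + p.1^2 / 120 + p.1^3 / 5040)^2
            + 3 * (p.1 / 6 + p.1^2 / 120 + p.1^3 / 5040) * p.2.1 * p.1^4
            + p.2.1^2 * p.1^8) / 3)
        + p.2.2 * (1/6 + p.1/120 + p.1^2/5040 + p.2.1 * p.1^3)^4) (by fun_prop) 2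
  refine ⟨K, hK, fun s a hs ha => ?_⟩
  set U := 1/6 + s/120 + s^2/5040 + a * s^3 with hU
  have hU2 : |a * s ^ 3| ≤ 1 / 64 := by
    rw [abs_mul, abs_pow]
    calc |a| * |s| ^ 3 ≤ 1 * (1 / 4) ^ 3 := by gcongr
      _ = 1 / 64 := by norm_num
  have hU1 : 1 / 12 ≤ U ∧ U ≤ 1 / 4 := by
    have := abs_le.1 hU2
    have := abs_le.1 hs
    constructor <;> nlinarith
  have hu : |s * U| ≤ 1 / 16 := by
    rw [abs_mul, abs_of_pos (by linarith : 0 < U)]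
    nlinarith [abs_nonneg s]
  obtain ⟨e, he, hlog⟩ := exists_log_eq_cubic (hu.trans (by norm_num))
  have harg : 1 + s / 6 + s ^ 2 / 120 + s ^ 3 / 5040 + a * s ^ 4 = 1 + s * U := by
    rw [hU]; ring
  rw [harg]
  refine ⟨_, hE s a e (by linarith) (by linarith) he, ?_, ?_⟩
  · rw [hlog, hU]; ring
  · set u := s * U with hu_def
    have hfac : log (1 + u) = u * (1 - u / 2 + u ^ 2 / 3 + e * u ^ 3) := by rw [hlog]; ring
    have heu : |e * u ^ 3| ≤ 1 / 4 := by
      rw [abs_mul, abs_pow]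
      calc |e| * |u| ^ 3 ≤ 2 * (1 / 16) ^ 3 := by gcongr
        _ ≤ 1 / 4 := by norm_num
    have hlow : 1 / 2 ≤ 1 - u / 2 + u ^ 2 / 3 + e * u ^ 3 := by
      have := abs_le.1 heu
      have := abs_le.1 hu
      linarith [sq_nonneg u]
    rw [hfac, abs_mul, abs_of_pos (by linarith : 0 < 1 - u / 2 + u ^ 2 / 3 + e * u ^ 3), hu_def,
      abs_mul, abs_of_pos (by linarith : 0 < U), ← hu_def]
    calc |s| = 24 * (|s| * (1 / 12) * (1 / 2)) := by ring
      _ ≤ 24 * (|s| * U * (1 - u / 2 + u ^ 2 / 3 + e * u ^ 3)) := by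
        have hU0 : 0 < U := by linarith
        gcongr
        exact hU1.1

theorem cosh_remainder_bounds {s b : ℝ} (hs : |s| ≤ 1 / 4) (hb : |b| ≤ 1) :
    |1 + s / 2 + s ^ 2 / 24 + s ^ 3 / 720 + b * s ^ 4 - 1| ≤ |s| := by
  have h1 : |b * s ^ 3| ≤ 1 / 64 := by
    rw [abs_mul, abs_pow]
    calc |b| * |s| ^ 3 ≤ 1 * (1 / 4) ^ 3 := by gcongr
      _ = 1 / 64 := by norm_num
  have h2 : |1 / 2 + s / 24 + s ^ 2 / 720 + b * s ^ 3| ≤ 1 := by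
    have := abs_le.1 h1
    have := abs_le.1 hs
    rw [abs_le]
    constructor <;> nlinarith
  calc _ = |s| * |1 / 2 + s / 24 + s ^ 2 / 720 + b * s ^ 3| := by rw [← abs_mul]; congr 1; ring
    _ ≤ |s| * 1 := by gcongr
    _ = |s| := mul_one _

/-- The expansion of the rate function derivative, in the uniformizing variable `s = β²`. -/
theorem exists_deriv_expansion_bound :
    ∃ C > 0, ∀ s k c a b : ℝ, s ≠ 0 → |s| ≤ 1 / 4 → |a| ≤ 1 → |b| ≤ 1 →
      k = 1 + s / 6 + s ^ 2 / 120 + s ^ 3 / 5040 + a * s ^ 4 →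
      c = 1 + s / 2 + s ^ 2 / 24 + s ^ 3 / 720 + b * s ^ 4 →
      |k * (s / (1 + c)) / (3 * log k) - 1 + (3/10) * log k - (109/1050) * (log k) ^ 2|
        ≤ C * |log k| ^ 3 := by
  obtain ⟨K, hK, hexp⟩ := exists_log_sinhc_expansion
  obtain ⟨Q, hQ, hQb⟩ := exists_forall_abs_le_of_continuous
    (f := fun p : ℝ × ℝ × ℝ =>
      3*p.2.2 - (9/10) * (2 * (p.1/6 - p.1^2/180 + p.1^3/2835) * p.2.2 + p.2.2^2 * p.1^4)
        + (109/350) * (3 * (p.1/6 - p.1^2/180 + p.1^3/2835)^2 * p.2.2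
          + 3 * (p.1/6 - p.1^2/180 + p.1^3/2835) * p.2.2^2 * p.1^4 + p.2.2^3 * p.1^8))
    (by fun_prop) (max K 1)
  obtain ⟨R, hR, hRb⟩ := exists_forall_abs_le_of_continuous
    (f := fun p : ℝ × ℝ × ℝ =>
      (-29/100800) + (-5633/476280000)*p.1 + (-40163/28576800000)*p.1^2
        + (-10159/720135360000)*p.1^3 + (-58873/10802030400000)*p.1^4
        + (5790467/40831674912000000)*p.1^5 + (-213967/10207918728000000)*p.1^6
        + (2507/7655939046000000)*p.1^7 + (-109/5741954284500000)*p.1^8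
        + p.1 * p.2.1
        - (2 + p.1 / 2 + p.1 ^ 2 / 24 + p.1 ^ 3 / 720) * p.2.2) (by fun_prop) (max Q 1)
  obtain ⟨T, hT, hTb⟩ := exists_forall_abs_le_of_continuous
    (f := fun p : ℝ × ℝ × ℝ =>
      p.2.1 * (3 * (p.1/6 - p.1^2/180 + p.1^3/2835 + p.2.2 * p.1^4)
        - (9/10) * (p.1/6 - p.1^2/180 + p.1^3/2835 + p.2.2 * p.1^4)^2
        + (109/350) * (p.1/6 - p.1^2/180 + p.1^3/2835 + p.2.2 * p.1^4)^3)) (by fun_prop) (max K 1)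
  refine ⟨24 ^ 4 * (R + T), by positivity, fun s k c a b hs0 hs ha hb hk hc => ?_⟩
  obtain ⟨E, hE, hL, hsL⟩ := hexp s a hs ha
  rw [← hk] at hL hsL
  have hc1 : 1 ≤ 1 + c := by
    have := cosh_remainder_bounds hs hb
    rw [← hc] at this
    have := abs_le.1 (this.trans hs)
    linarith
  have hs1 : ∀ x, |s| ≤ max x 1 := fun x => (hs.trans (by norm_num)).trans (le_max_right x 1)
  have hq := hQb s 0 E (hs1 _) (by simp) (hE.trans (le_max_left _ _))
  have hr := hRb s a _ (hs1 _) (ha.trans (le_max_right _ _)) (hq.trans (le_max_left _ _))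
  have ht := hTb s b E (hs1 _) (hb.trans (le_max_right _ _)) (hE.trans (le_max_left _ _))
  set L := log k with hLdef
  have hL0 : 0 < |L| := by
    have := abs_pos.2 hs0
    linarith
  have hL0' : L ≠ 0 := abs_pos.1 hL0
  have hnum : |s * k - (1 + c) * (3 * L - (9/10) * L ^ 2 + (109/350) * L ^ 3)|
      ≤ (R + T) * |s| ^ 4 := by
    have h := (abs_sub _ _).trans (add_le_add hr ht)
    rw [← abs_pow]
    refine le_trans (le_of_eq ?_) (mul_le_mul_of_nonneg_right h (abs_nonneg (s ^ 4)))
    rw [← abs_mul]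
    congr 1
    rw [hL, hk, hc]
    ring
  have hfrac : k * (s / (1 + c)) / (3 * L) - 1 + (3/10) * L - (109/1050) * L ^ 2
      = (s * k - (1 + c) * (3 * L - (9/10) * L ^ 2 + (109/350) * L ^ 3)) / ((1 + c) * (3 * L)) := by
    field_simp
    ring
  rw [hfrac, abs_div, abs_mul, abs_mul, abs_of_pos (by linarith : 0 < 1 + c),
    abs_of_pos (by norm_num : (0:ℝ) < 3), div_le_iff₀ (by positivity)]
  calc _ ≤ (R + T) * |s| ^ 4 := hnum
    _ ≤ (R + T) * (24 * |L|) ^ 4 := by gcongr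
    _ = (24 ^ 4 * (R + T)) * |L| ^ 3 * (1 * (1 * |L|)) := by ring
    _ ≤ _ := by gcongr; norm_num

theorem sinh_cosh_expansion {z : ℂ} {s k c : ℝ} (hz0 : z ≠ 0) (hzs : z ^ 2 = s) (hs : |s| ≤ 1)
    (hk : k * z = Complex.sinh z) (hc : Complex.cosh z = c) :
    (∃ a, |a| ≤ 1 ∧ k = 1 + s / 6 + s ^ 2 / 120 + s ^ 3 / 5040 + a * s ^ 4) ∧
      ∃ b, |b| ≤ 1 ∧ c = 1 + s / 2 + s ^ 2 / 24 + s ^ 3 / 720 + b * s ^ 4 := by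
  have hn : ‖z‖ ^ 2 = |s| := by rw [← norm_pow, hzs, Complex.norm_real, Real.norm_eq_abs]
  have hz1 : ‖z‖ ≤ 1 := by nlinarith [norm_nonneg z]
  have hz1' : ‖-z‖ ≤ 1 := by rwa [norm_neg]
  have hzp : 0 < ‖z‖ := norm_pos_iff.2 hz0
  constructor
  · have h1 := Complex.exp_bound hz1 (n := 9) (by norm_num)
    have h2 := Complex.exp_bound hz1' (n := 9) (by norm_num)
    rw [norm_neg] at h2
    have h3 := (norm_sub_le _ _).trans (add_le_add h1 h2)
    have key : |k - (1 + s / 6 + s ^ 2 / 120 + s ^ 3 / 5040)| ≤ 1 * |s ^ 4| := by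
      refine le_of_mul_le_mul_left ?_ (mul_pos (by norm_num : (0:ℝ) < 2) hzp)
      calc 2 * ‖z‖ * |k - (1 + s / 6 + s ^ 2 / 120 + s ^ 3 / 5040)|
          = ‖2 * z * ((k - (1 + s / 6 + s ^ 2 / 120 + s ^ 3 / 5040) : ℝ) : ℂ)‖ := by
            rw [norm_mul, norm_mul, Complex.norm_real, Real.norm_eq_abs]; norm_num
        _ ≤ _ := le_trans (le_of_eq ?_) h3
        _ ≤ 2 * ‖z‖ * (1 * |s ^ 4|) := by
            rw [abs_pow, ← hn]
            norm_num [Nat.factorial]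
            have := pow_pos hzp 9
            nlinarith
      congr 1
      have : 2 * z * (k : ℂ) = Complex.exp z - Complex.exp (-z) := by
        rw [mul_assoc, mul_comm z, hk, Complex.sinh]; ring
      push_cast
      rw [mul_sub, this, ← hzs]
      norm_num [Finset.sum_range_succ, Nat.factorial]
      ring
    obtain ⟨a, ha, h⟩ := exists_eq_mul_of_abs_le (by norm_num) key
    exact ⟨a, ha, by linarith⟩
  · have h1 := Complex.exp_bound hz1 (n := 8) (by norm_num)
    have h2 := Complex.exp_bound hz1' (n := 8) (by norm_num)
    rw [norm_neg] at h2
    have h3 := (norm_add_le _ _).trans (add_le_add h1 h2)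
    have key : |c - (1 + s / 2 + s ^ 2 / 24 + s ^ 3 / 720)| ≤ 1 * |s ^ 4| := by
      refine le_of_mul_le_mul_left ?_ (by norm_num : (0:ℝ) < 2)
      calc 2 * |c - (1 + s / 2 + s ^ 2 / 24 + s ^ 3 / 720)|
          = ‖2 * ((c - (1 + s / 2 + s ^ 2 / 24 + s ^ 3 / 720) : ℝ) : ℂ)‖ := by
            rw [norm_mul, Complex.norm_real, Real.norm_eq_abs]; norm_num
        _ ≤ _ := le_trans (le_of_eq ?_) h3
        _ ≤ 2 * (1 * |s ^ 4|) := by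
            rw [abs_pow, ← hn]
            norm_num [Nat.factorial]
            have := pow_pos hzp 8
            nlinarith
      congr 1
      have : 2 * (c : ℂ) = Complex.exp z + Complex.exp (-z) := by
        rw [← hc, Complex.cosh]; ring
      push_cast
      rw [mul_sub, this, ← hzs]
      norm_num [Finset.sum_range_succ, Nat.factorial]
      ring
    obtain ⟨b, hb, h⟩ := exists_eq_mul_of_abs_le (by norm_num) key
    exact ⟨b, hb, by linarith⟩

/-- Derivative of a function given parametrically: `J (f x) = g x`. -/
theorem HasStrictDerivAt.hasDerivAt_of_param {J f g : ℝ → ℝ} {f' g' x : ℝ}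
    (hf : HasStrictDerivAt f f' x) (hf' : f' ≠ 0) (hg : HasDerivAt g g' x)
    (h : ∀ᶠ y in 𝓝 x, J (f y) = g y) : HasDerivAt J (g' / f') (f x) := by
  have hinv := hf.to_localInverse hf'
  have hx : hf.localInverse f f' x hf' (f x) = x :=
    HasStrictFDerivAt.localInverse_apply_image _
  have hcomp : HasDerivAt (g ∘ hf.localInverse f f' x hf') (g' * f'⁻¹) (f x) := by
    refine HasDerivAt.comp _ ?_ hinv.hasDerivAt
    rwa [hx]
  rw [div_eq_mul_inv]
  refine hcomp.congr_of_eventuallyEq ?_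
  have hcont := hinv.hasDerivAt.continuousAt.tendsto
  rw [hx] at hcont
  filter_upwards [hcont.eventually h, hf.eventually_right_inverse hf'] with y hy1 hy2
  rw [hy2] at hy1
  exact hy1

theorem mul_one_add_sq_div_le_sinh {x : ℝ} (hx : 0 ≤ x) : x * (1 + x ^ 2 / 8) ≤ sinh x := by
  have h4 : x / 4 ≤ sinh (x / 4) := self_le_sinh_iff.2 (by linarith)
  have h2 : x / 2 ≤ sinh (x / 2) := self_le_sinh_iff.2 (by linarith)
  have hc : 1 + x ^ 2 / 8 ≤ cosh (x / 2) := by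
    rw [show x / 2 = 2 * (x / 4) by ring, cosh_two_mul, cosh_sq]
    nlinarith
  rw [show sinh x = 2 * sinh (x / 2) * cosh (x / 2) by rw [← sinh_two_mul]; ring_nf]
  calc x * (1 + x ^ 2 / 8) = 2 * (x / 2) * (1 + x ^ 2 / 8) := by ring
    _ ≤ _ := by gcongr

theorem sinh_lt_mul_cosh {x : ℝ} (hx : 0 < x) : sinh x < x * cosh x := by
  obtain ⟨y, hy, h⟩ := exists_hasDerivAt_eq_slope sinh cosh hx continuous_sinh.continuousOn
    fun t _ => hasDerivAt_sinh t
  have hlt : cosh y < cosh x := by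
    rw [cosh_lt_cosh, abs_of_pos hy.1, abs_of_pos hx]
    exact hy.2
  rw [h, sinh_zero, sub_zero, sub_zero, div_lt_iff₀ hx] at hlt
  linarith

theorem mul_cos_lt_sin {x : ℝ} (hx : 0 < x) (hx' : x ≤ π) : x * cos x < sin x := by
  obtain ⟨y, hy, h⟩ := exists_hasDerivAt_eq_slope sin cos hx continuous_sin.continuousOn
    fun t _ => hasDerivAt_sin t
  have hlt : cos x < cos y := cos_lt_cos_of_nonneg_of_le_pi hy.1.le hx' hy.2
  rw [h, sin_zero, sub_zero, sub_zero, lt_div_iff₀ hx] at hlt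
  linarith

theorem sin_le_mul_one_sub_sq {x : ℝ} (hx : 0 ≤ x) (hx' : x ≤ π) :
    sin x ≤ x * (1 - x ^ 2 / 20) := by
  have hc := cos_le_one_sub_mul_cos_sq (x := x / 2) (by rw [abs_of_nonneg] <;> linarith)
  have hs : sin (x / 2) ≤ x / 2 := sin_le (by linarith)
  have hc0 : 0 ≤ cos (x / 2) := cos_nonneg_of_mem_Icc ⟨by linarith [pi_pos], by linarith⟩
  have hpi : 1 / 20 * 4 ≤ 2 / π ^ 2 := by
    rw [le_div_iff₀ (by positivity)]
    nlinarith [pi_lt_d2, pi_pos]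
  rw [show sin x = 2 * sin (x / 2) * cos (x / 2) by rw [← sin_two_mul]; ring_nf]
  calc 2 * sin (x / 2) * cos (x / 2) ≤ 2 * (x / 2) * cos (x / 2) := by gcongr
    _ = x * cos (x / 2) := by ring
    _ ≤ _ := by
      gcongr
      nlinarith [sq_nonneg x]

theorem sinhc_eq_dslope : sinhc = dslope sinh 0 := by
  ext b
  rcases eq_or_ne b 0 with rfl | hb
  · simp [sinhc]
  · simp [sinhc, hb, dslope_of_ne, slope_def_field]

theorem continuous_sinhc : Continuous sinhc := by
  rw [sinhc_eq_dslope, ← continuousOn_univ, continuousOn_dslope univ_mem]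
  exact ⟨continuous_sinh.continuousOn, differentiable_sinh _⟩

theorem exists_sinh_eq_mul {k : ℝ} (hk : 1 < k) : ∃ x > 0, sinh x = k * x := by
  have hB : k ≤ sinhc (8 * k) := by
    have := mul_one_add_sq_div_le_sinh (x := 8 * k) (by linarith)
    rw [sinhc, if_neg (by linarith), le_div_iff₀ (by linarith)]
    nlinarith
  obtain ⟨x, hx, h⟩ := intermediate_value_Icc (by linarith : (0:ℝ) ≤ 8 * k)
    continuous_sinhc.continuousOn ⟨by simpa [sinhc] using hk.le, hB⟩
  have hx0 : x ≠ 0 := by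
    rintro rfl
    simp [sinhc] at h
    linarith
  refine ⟨x, lt_of_le_of_ne hx.1 hx0.symm, ?_⟩
  rw [← h, sinhc, if_neg hx0]
  field_simp

theorem exists_sin_eq_mul {k : ℝ} (hk0 : 0 < k) (hk : k < 1) :
    ∃ x, 0 < x ∧ x < π ∧ sin x = k * x := by
  obtain ⟨x, hx, h⟩ := intermediate_value_Icc' pi_pos.le
    continuous_sinc.continuousOn (show k ∈ Icc (sinc π) (sinc 0) by
      simp [sinc_of_ne_zero pi_ne_zero, hk0.le, hk.le])
  have hx0 : x ≠ 0 := by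
    rintro rfl
    simp at h
    linarith
  rw [sinc_of_ne_zero hx0, div_eq_iff hx0] at h
  refine ⟨x, lt_of_le_of_ne hx.1 hx0.symm, lt_of_le_of_ne hx.2 ?_, h⟩
  rintro rfl
  rw [sin_pi] at h
  have := mul_pos hk0 pi_pos
  linarith

theorem IsJBS.apply_one {J : ℝ → ℝ} (hJ : IsJBS J) : J 1 = 0 := by
  simpa using hJ.1 1 le_rfl 0 le_rfl (by simp [sinhc])

theorem IsJBS.apply_sinh_div {J : ℝ → ℝ} (hJ : IsJBS J) {x : ℝ} (hx : 0 < x) :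
    J (sinh x / x) = x ^ 2 / 2 - x * (sinh x / (1 + cosh x)) := by
  have h1 : 1 ≤ sinh x / x := by
    rw [le_div_iff₀ hx, one_mul]
    exact self_le_sinh_iff.2 hx.le
  rw [hJ.1 _ h1 x hx.le (by simp [sinhc, hx.ne'])]
  congr 2
  obtain ⟨y, rfl⟩ : ∃ y, x = 2 * y := ⟨x / 2, by ring⟩
  have hc := cosh_pos y
  rw [mul_div_cancel_left₀ _ two_ne_zero, tanh_eq_sinh_div_cosh, sinh_two_mul, cosh_two_mul,
    show 1 + (cosh y ^ 2 + sinh y ^ 2) = 2 * cosh y ^ 2 by rw [cosh_sq]; ring]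
  field_simp

theorem IsJBS.apply_sin_div {J : ℝ → ℝ} (hJ : IsJBS J) {x : ℝ} (hx : 0 < x) (hx' : x < π) :
    J (sin x / x) = x * (sin x / (1 + cos x)) - x ^ 2 / 2 := by
  have h0 : 0 < sin x / x := div_pos (sin_pos_of_pos_of_lt_pi hx hx') hx
  have h1 : sin x / x ≤ 1 := by
    rw [div_le_one hx]
    exact sin_le hx.le
  obtain ⟨y, rfl⟩ : ∃ y, x = 2 * y := ⟨x / 2, by ring⟩
  have hy : y ≠ 0 := by linarith
  rw [hJ.2 _ h0 h1 y ⟨by linarith, by linarith⟩ (by simp [sinc2, hy])]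
  have hc : cos y ≠ 0 := (cos_pos_of_mem_Ioo ⟨by linarith, by linarith⟩).ne'
  rw [tan_eq_sin_div_cos, sin_two_mul, cos_two_mul,
    show 1 + (2 * cos y ^ 2 - 1) = 2 * cos y ^ 2 by ring]
  field_simp

theorem IsJBS.hasDerivAt_sinh_div {J : ℝ → ℝ} (hJ : IsJBS J) {x : ℝ} (hx : 0 < x) :
    HasDerivAt J (x ^ 2 / (1 + cosh x)) (sinh x / x) := by
  have hc : 1 + cosh x ≠ 0 := by positivity
  have hd : x * cosh x - sinh x ≠ 0 := by linarith [sinh_lt_mul_cosh hx]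
  have hf : HasStrictDerivAt (fun x => sinh x / x) ((cosh x * x - sinh x * 1) / x ^ 2) x :=
    (hasStrictDerivAt_sinh x).div (hasStrictDerivAt_id x) hx.ne'
  have hf' : (cosh x * x - sinh x * 1) / x ^ 2 ≠ 0 :=
    div_ne_zero (by rwa [mul_comm, mul_one]) (by positivity)
  have hg := (((hasDerivAt_id' x).fun_pow 2).div_const 2).fun_sub ((hasDerivAt_id' x).fun_mul
    ((hasDerivAt_sinh x).fun_div ((hasDerivAt_cosh x).const_add 1) hc))
  convert hf.hasDerivAt_of_param hf' hg ?_ using 1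
  · have h2 : sinh x * sinh x = cosh x ^ 2 - 1 := by rw [cosh_sq]; ring
    have hd' : cosh x * x - sinh x ≠ 0 := by rwa [mul_comm]
    rw [h2]
    field_simp
    ring
  · filter_upwards [eventually_gt_nhds hx] with y hy using hJ.apply_sinh_div hy

theorem IsJBS.hasDerivAt_sin_div {J : ℝ → ℝ} (hJ : IsJBS J) {x : ℝ} (hx : 0 < x) (hx' : x < π) :
    HasDerivAt J (-x ^ 2 / (1 + cos x)) (sin x / x) := by
  have hc : 1 + cos x ≠ 0 := by
    have := cos_lt_cos_of_nonneg_of_le_pi hx.le le_rfl hx'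
    rw [cos_pi] at this
    linarith
  have hd : x * cos x - sin x ≠ 0 := by linarith [mul_cos_lt_sin hx hx'.le]
  have hf : HasStrictDerivAt (fun x => sin x / x) ((cos x * x - sin x * 1) / x ^ 2) x :=
    (hasStrictDerivAt_sin x).div (hasStrictDerivAt_id x) hx.ne'
  have hf' : (cos x * x - sin x * 1) / x ^ 2 ≠ 0 :=
    div_ne_zero (by rwa [mul_comm, mul_one]) (by positivity)
  have hg := ((hasDerivAt_id' x).fun_mul
    ((hasDerivAt_sin x).fun_div ((hasDerivAt_cos x).const_add 1) hc)).fun_sub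
      (((hasDerivAt_id' x).fun_pow 2).div_const 2)
  convert hf.hasDerivAt_of_param hf' hg ?_ using 1
  · have h2 : sin x * -sin x = cos x ^ 2 - 1 := by rw [cos_sq']; ring
    have hd' : cos x * x - sin x ≠ 0 := by rwa [mul_comm]
    rw [h2]
    field_simp
    ring
  · filter_upwards [eventually_gt_nhds hx, eventually_lt_nhds hx'] with y hy hy'
      using hJ.apply_sin_div hy hy'

/-- Both branches of `J_BS` in terms of one complex parameter `z` with `sinh z / z = k`:
`z = β` for `k > 1` and `z = 2ξi` for `k < 1`. -/
theorem IsJBS.exists_param {J : ℝ → ℝ} (hJ : IsJBS J) {k : ℝ} (hk0 : 0 < k) (hk : k ≠ 1) :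
    ∃ (z : ℂ) (s c : ℝ), z ≠ 0 ∧ z ^ 2 = s ∧ k * z = Complex.sinh z ∧ Complex.cosh z = c ∧
      |s| ≤ 20 * |k - 1| ∧ J k = s / 2 - s * (k / (1 + c)) ∧ HasDerivAt J (s / (1 + c)) k := by
  rcases lt_or_gt_of_ne hk with hlt | hgt
  · obtain ⟨x, hx, hx', h⟩ := exists_sin_eq_mul hk0 hlt
    have hkx : k = sin x / x := by rw [h]; field_simp
    refine ⟨x * Complex.I, -x ^ 2, cos x, by simp [hx.ne'], ?_, ?_, ?_, ?_, ?_, ?_⟩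
    · rw [mul_pow, Complex.I_sq]; push_cast; ring
    · rw [Complex.sinh_mul_I, ← Complex.ofReal_sin, h]; push_cast; ring
    · rw [Complex.cosh_mul_I, Complex.ofReal_cos]
    · rw [abs_neg, abs_of_nonneg (sq_nonneg x), abs_of_neg (by linarith)]
      have := sin_le_mul_one_sub_sq hx.le hx'.le
      rw [h, mul_comm] at this
      have := le_of_mul_le_mul_left this hx
      linarith
    · have : J k = J (sin x / x) := by rw [← hkx]
      rw [this, hJ.apply_sin_div hx hx', h]
      ring
    · have := hJ.hasDerivAt_sin_div hx hx'
      rwa [← hkx] at this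
  · obtain ⟨x, hx, h⟩ := exists_sinh_eq_mul hgt
    have hkx : k = sinh x / x := by rw [h]; field_simp
    refine ⟨x, x ^ 2, cosh x, by simp [hx.ne'], by push_cast; ring, ?_, by simp, ?_, ?_, ?_⟩
    · rw [← Complex.ofReal_sinh, h]; push_cast; ring
    · rw [abs_of_nonneg (sq_nonneg x), abs_of_pos (by linarith)]
      have := mul_one_add_sq_div_le_sinh hx.le
      rw [h, mul_comm k] at this
      have := le_of_mul_le_mul_left this hx
      linarith
    · have : J k = J (sinh x / x) := by rw [← hkx]
      rw [this, hJ.apply_sinh_div hx, h]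
      ring
    · have := hJ.hasDerivAt_sinh_div hx
      rwa [← hkx] at this

theorem IsJBS.abs_le_sq {J : ℝ → ℝ} (hJ : IsJBS J) {k : ℝ} (hk : |k - 1| < 1 / 80) :
    |J k| ≤ 220 * |k - 1| ^ 2 := by
  rcases eq_or_ne k 1 with rfl | hk1
  · simp [hJ.apply_one]
  obtain ⟨z, s, c, hz0, hzs, hkz, hc, hsk, hJk, -⟩ :=
    hJ.exists_param (by linarith [(abs_lt.1 hk).1]) hk1
  have hs : |s| ≤ 1 / 4 := by linarith
  obtain ⟨-, b, hb, hcb⟩ := sinh_cosh_expansion hz0 hzs (by linarith) hkz hc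
  have hcs := cosh_remainder_bounds hs hb
  rw [← hcb] at hcs
  have hc1 : 1 ≤ 1 + c := by linarith [(abs_le.1 (hcs.trans hs)).1]
  have hJ' : J k = s * ((c - 1) - 2 * (k - 1)) / (2 * (1 + c)) := by
    rw [hJk]
    field_simp
    ring
  have hsub : |(c - 1) - 2 * (k - 1)| ≤ 22 * |k - 1| := by
    refine (abs_sub _ _).trans ?_
    rw [abs_mul, abs_two]
    linarith
  rw [hJ', abs_div, abs_mul, abs_of_pos (by linarith : 0 < 2 * (1 + c)),
    div_le_iff₀ (by linarith)]
  calc |s| * |(c - 1) - 2 * (k - 1)| ≤ (20 * |k - 1|) * (22 * |k - 1|) := by gcongr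
    _ = 220 * |k - 1| ^ 2 * (2 * 1) := by ring
    _ ≤ _ := by gcongr

theorem IsJBS.hasDerivAt_one {J : ℝ → ℝ} (hJ : IsJBS J) : HasDerivAt J 0 1 := by
  have h : J =O[𝓝 1] fun k => ‖k - 1‖ ^ 2 := by
    refine Asymptotics.IsBigO.of_bound 220 ?_
    filter_upwards [Metric.ball_mem_nhds (1 : ℝ) (by norm_num : (0 : ℝ) < 1 / 80)] with k hk
    simpa using hJ.abs_le_sq (by simpa [Real.dist_eq] using hk)
  simpa using (h.hasFDerivAt (by norm_num)).hasDerivAt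

theorem IsJBS.differentiableAt {J : ℝ → ℝ} (hJ : IsJBS J) {k : ℝ} (hk : 0 < k) :
    DifferentiableAt ℝ J k := by
  rcases eq_or_ne k 1 with rfl | hk1
  · exact hJ.hasDerivAt_one.differentiableAt
  · obtain ⟨_, _, _, _, _, _, _, _, _, h⟩ := hJ.exists_param hk hk1
    exact h.differentiableAt

/-- `J_BS` is differentiable on `(0, ∞)` and near `k = 1` its derivative satisfies
`J_BS′(k) = (3/k)·log k·(1 − (3/10) log k + (109/1050) log²k + O(log³k))`. -/
theorem jbs_deriv_taylor (J : ℝ → ℝ) (hJ : IsJBS J) :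
    ∃ J' : ℝ → ℝ, (∀ k : ℝ, 0 < k → HasDerivAt J (J' k) k) ∧
      ∃ C > (0:ℝ), ∃ δ > (0:ℝ), ∀ k : ℝ, k ≠ 1 → |k - 1| < δ →
        |k * J' k / (3 * Real.log k) - 1 + (3/10) * Real.log k
            - (109/1050) * (Real.log k) ^ 2|
          ≤ C * |Real.log k| ^ 3 := by
  refine ⟨deriv J, fun k hk => (hJ.differentiableAt hk).hasDerivAt, ?_⟩
  obtain ⟨C, hC, hbound⟩ := exists_deriv_expansion_bound
  refine ⟨C, hC, 1 / 80, by norm_num, fun k hk1 hk => ?_⟩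
  obtain ⟨z, s, c, hz0, hzs, hkz, hc, hsk, -, hder⟩ :=
    hJ.exists_param (by linarith [(abs_lt.1 hk).1]) hk1
  have hs : |s| ≤ 1 / 4 := by linarith
  obtain ⟨⟨a, ha, hka⟩, b, hb, hcb⟩ := sinh_cosh_expansion hz0 hzs (by linarith) hkz hc
  have hs0 : s ≠ 0 := by
    rintro rfl
    exact hz0 (pow_eq_zero_iff two_ne_zero |>.1 (by simpa using hzs))
  rw [hder.deriv]
  exact hbound s k c a b hs0 hs ha hb hka hcb
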